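/- Let (T(u))_{u≥0} be a C₀ semigroup of contractions on a real Banach space B and let r ≥ 1 be an integer. Define w_T^r(f, t) = (1/t) ∫_0^t ‖(T(u) − I)^r f‖ du and ω_T^r(f, t) = sup_{0 ≤ u ≤ t} ‖(T(u) − I)^r f‖. Then there is a constant C(r) > 0, depending only on r, such that for all f ∈ B and t > 0: w_T^r(f, t) ≤ ω_T^r(f, t) ≤ C(r) w_T^r(f, t). -/

import Mathlib

open Filter MeasureTheory

theorem sub_one_pow_eq_sum {R : Type*} [Ring R] (x : R) (r : ℕ) :
    (x - 1) ^ r =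
      ∑ j ∈ Finset.range (r + 1), ((-1) ^ (r - j) * (r.choose j : R)) * x ^ j := by
  rw [sub_eq_add_neg, ((Commute.one_right x).neg_right).add_pow]
  refine Finset.sum_congr rfl fun j _ => ?_
  have h₁ : Commute (x ^ j) ((-1) ^ (r - j)) := ((Commute.one_right _).neg_right).pow_right _
  have h₂ : Commute (x ^ j) (r.choose j : R) := Nat.commute_cast _ _
  rw [mul_assoc]
  exact (h₁.mul_right h₂).eq

/-- The identity that expresses an `r`-th difference with step `h` through `r`-th differences with
steps `k s` and `h + k s`, written in terms of commuting elements `a = T h` and `b = T s`. -/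
theorem sum_choose_mul_pow_sub_one_pow {R : Type*} [Ring R] {a b : R} (hab : Commute a b) (r : ℕ) :
    ∑ k ∈ Finset.range (r + 1), ((-1) ^ k * (r.choose k : R)) * (a ^ k * (b ^ k - 1) ^ r) =
      ∑ k ∈ Finset.range (r + 1), ((-1) ^ k * (r.choose k : R)) * (a * b ^ k - 1) ^ r := by
  have hsign {j : ℕ} (hj : j ∈ Finset.range (r + 1)) : (-1 : R) ^ r * (-1) ^ j = (-1) ^ (r - j) := by
    obtain ⟨m, rfl⟩ := Nat.exists_eq_add_of_le (Nat.lt_succ_iff.mp (Finset.mem_range.mp hj))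
    rw [Nat.add_sub_cancel_left, ← pow_add, show j + m + j = 2 * j + m by ring, pow_add, pow_mul]
    simp
  have hsc (n m : ℕ) (x : R) : Commute x ((-1) ^ n * (m : R)) :=
    (((Commute.one_right x).neg_right).pow_right n).mul_right (Nat.commute_cast _ _)
  simp_rw [sub_one_pow_eq_sum, Finset.mul_sum]
  rw [Finset.sum_comm]
  refine Finset.sum_congr rfl fun j hj => Finset.sum_congr rfl fun k hk => ?_
  have hpow : (a * b ^ j) ^ k = a ^ k * (b ^ k) ^ j := by
    rw [(hab.pow_right j).mul_pow, ← pow_mul, ← pow_mul, mul_comm j k]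
  have hcoef : ((-1) ^ k * (r.choose k : R)) * ((-1) ^ (r - j) * (r.choose j : R)) =
      ((-1) ^ j * (r.choose j : R)) * ((-1) ^ (r - k) * (r.choose k : R)) := by
    have h₁ : (-1 : R) ^ k * (-1) ^ (r - j) = (-1) ^ j * (-1) ^ (r - k) := by
      rw [← hsign hj, ← hsign hk, ← pow_add, ← pow_add, ← pow_add, ← pow_add]
      congr 1
      ring
    rw [(Nat.cast_commute (r.choose k) ((-1 : R) ^ (r - j))).mul_mul_mul_comm, h₁,
      (Nat.cast_commute (r.choose j) ((-1 : R) ^ (r - k))).mul_mul_mul_comm,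
      (Nat.cast_commute (r.choose k) (r.choose j : R)).eq]
  rw [hpow, ← mul_assoc (a ^ k), (hsc _ _ (a ^ k)).eq, mul_assoc _ (a ^ k), ← mul_assoc, hcoef,
    mul_assoc]

theorem intervalIntegral_comp_add_mul_le {φ : ℝ → ℝ} (hφ : Continuous φ) (h0 : ∀ u, 0 ≤ φ u)
    {a c δ t : ℝ} (ha : 0 ≤ a) (hc : 1 ≤ c) (hδ : 0 ≤ δ) (hat : a + c * δ ≤ t) :
    ∫ s in (0 : ℝ)..δ, φ (a + c * s) ≤ ∫ u in (0 : ℝ)..t, φ u := by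
  have hcδ : 0 ≤ c * δ := by positivity
  rw [intervalIntegral.integral_comp_add_mul _ (by positivity), mul_zero, add_zero, smul_eq_mul]
  have hnonneg : 0 ≤ ∫ u in a..(a + c * δ), φ u :=
    intervalIntegral.integral_nonneg (by linarith) fun u _ => h0 u
  calc c⁻¹ * ∫ u in a..(a + c * δ), φ u ≤ 1 * ∫ u in a..(a + c * δ), φ u := by
        gcongr
        exact inv_le_one_of_one_le₀ hc
    _ = ∫ u in a..(a + c * δ), φ u := one_mul _
    _ ≤ ∫ u in (0 : ℝ)..t, φ u :=
        intervalIntegral.integral_mono_interval ha (by linarith) hat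
          (Eventually.of_forall h0) (hφ.intervalIntegrable _ _)

/-- A function satisfying the difference inequality is controlled on `[0, t / 2]` by its mean over
`[0, t]`. -/
theorem le_mean_of_difference_inequality {φ : ℝ → ℝ} (hφ : Continuous φ) (h0 : ∀ u, 0 ≤ φ u)
    {r : ℕ} (hr : 1 ≤ r)
    (hdiff : ∀ h s, 0 ≤ h → 0 ≤ s → φ h ≤ ∑ k ∈ Finset.range r,
      (r.choose (k + 1) : ℝ) * (φ (0 + (k + 1 : ℝ) * s) + φ (h + (k + 1 : ℝ) * s)))
    {h t : ℝ} (hh : 0 ≤ h) (ht : 0 < t) (hht : h ≤ t / 2) :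
    φ h ≤ (4 * r * 2 ^ r) * ((1 / t) * ∫ u in (0 : ℝ)..t, φ u) := by
  have hr' : (0 : ℝ) < r := by exact_mod_cast hr
  set I := ∫ u in (0 : ℝ)..t, φ u with hI
  have hI0 : 0 ≤ I := intervalIntegral.integral_nonneg ht.le fun u _ => h0 u
  set δ := t / (2 * r) with hδ
  have hδ0 : 0 < δ := by positivity
  have hrδ : r * δ = t / 2 := by rw [hδ]; field_simp
  have hbound (a : ℝ) (ha : 0 ≤ a) (hat : a ≤ t / 2) {k : ℕ} (hk : k ∈ Finset.range r) :
      ∫ s in (0 : ℝ)..δ, φ (a + (k + 1 : ℝ) * s) ≤ I := by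
    have hk' : (k + 1 : ℝ) ≤ r := by exact_mod_cast Finset.mem_range.mp hk
    refine intervalIntegral_comp_add_mul_le hφ h0 ha (by linarith [k.cast_nonneg (α := ℝ)])
      hδ0.le ?_
    nlinarith
  have key : δ * φ h ≤ 2 ^ r * (2 * I) := by
    calc δ * φ h = ∫ _ in (0 : ℝ)..δ, φ h := by simp
      _ ≤ ∫ s in (0 : ℝ)..δ, ∑ k ∈ Finset.range r,
          (r.choose (k + 1) : ℝ) * (φ (0 + (k + 1 : ℝ) * s) + φ (h + (k + 1 : ℝ) * s)) := by
        refine intervalIntegral.integral_mono_on hδ0.le (by simp)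
          (Continuous.intervalIntegrable (by fun_prop) _ _) fun s hs => hdiff h s hh hs.1
      _ = ∑ k ∈ Finset.range r, (r.choose (k + 1) : ℝ) *
          ((∫ s in (0 : ℝ)..δ, φ (0 + (k + 1 : ℝ) * s)) +
            ∫ s in (0 : ℝ)..δ, φ (h + (k + 1 : ℝ) * s)) := by
        rw [intervalIntegral.integral_finsetSum
          fun k _ => Continuous.intervalIntegrable (by fun_prop) _ _]
        refine Finset.sum_congr rfl fun k _ => ?_
        rw [intervalIntegral.integral_const_mul, intervalIntegral.integral_add] <;>
          exact Continuous.intervalIntegrable (by fun_prop) _ _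
      _ ≤ ∑ k ∈ Finset.range r, (r.choose (k + 1) : ℝ) * (2 * I) := by
        refine Finset.sum_le_sum fun k hk => mul_le_mul_of_nonneg_left ?_ (Nat.cast_nonneg _)
        linarith [hbound 0 le_rfl (by positivity) hk, hbound h hh hht hk]
      _ ≤ 2 ^ r * (2 * I) := by
        rw [← Finset.sum_mul]
        gcongr
        have hsum := Nat.sum_range_choose r
        rw [Finset.sum_range_succ'] at hsum
        exact_mod_cast (Nat.le_add_right _ _).trans_eq hsum
  calc φ h = (2 * r / t) * (δ * φ h) := by rw [hδ]; field_simp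
    _ ≤ (2 * r / t) * (2 ^ r * (2 * I)) := by gcongr
    _ = (4 * r * 2 ^ r) * ((1 / t) * I) := by ring

section Semigroup

variable {B : Type*} [NormedAddCommGroup B] [NormedSpace ℝ B] {T : ℝ → B →L[ℝ] B}

theorem semigroup_pow (hT0 : T 0 = 1)
    (hadd : ∀ t u : ℝ, 0 ≤ t → 0 ≤ u → T (t + u) = T t ∘L T u) {u : ℝ} (hu : 0 ≤ u) (n : ℕ) :
    T u ^ n = T (n * u) := by
  induction n with
  | zero => simp [hT0]
  | succ n ih =>
    rw [pow_succ, ih, Nat.cast_succ, add_one_mul, hadd _ _ (by positivity) hu]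
    rfl

theorem semigroup_commute (hadd : ∀ t u : ℝ, 0 ≤ t → 0 ≤ u → T (t + u) = T t ∘L T u)
    {t u : ℝ} (ht : 0 ≤ t) (hu : 0 ≤ u) : Commute (T t) (T u) := by
  change T t ∘L T u = T u ∘L T t
  rw [← hadd t u ht hu, ← hadd u t hu ht, add_comm]

theorem contraction_semigroup_continuous_abs (hT0 : T 0 = 1)
    (hadd : ∀ t u : ℝ, 0 ≤ t → 0 ≤ u → T (t + u) = T t ∘L T u)
    (hcont : ∀ f : B, Tendsto (fun t : ℝ => T t f) (nhdsWithin 0 (Set.Ioi 0)) (nhds f))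
    (hcontr : ∀ t : ℝ, 0 ≤ t → ∀ f : B, ‖T t f‖ ≤ ‖f‖) (f : B) :
    Continuous fun u : ℝ => T |u| f := by
  have hmono {a b : ℝ} (ha : 0 ≤ a) (hab : a ≤ b) : ‖T b f - T a f‖ ≤ ‖T |b - a| f - f‖ := by
    have hb : T b f = T a (T (b - a) f) := by
      have := hadd a (b - a) ha (by linarith)
      rw [add_sub_cancel] at this
      rw [this]
      rfl
    rw [hb, ← map_sub, abs_of_nonneg (sub_nonneg.mpr hab)]
    exact hcontr a ha _
  rw [Metric.continuous_iff]
  intro b ε hε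
  obtain ⟨δ, hδ, hball⟩ := Metric.tendsto_nhdsWithin_nhds.mp (hcont f) ε hε
  have hsmall {d : ℝ} (hd : |d| < δ) : ‖T |d| f - f‖ < ε := by
    rcases (abs_nonneg d).eq_or_lt with h | h
    · simpa [← h, hT0] using hε
    · rw [← dist_eq_norm]
      exact hball h (by simpa [Real.dist_eq] using hd)
  refine ⟨δ, hδ, fun a ha => ?_⟩
  rw [Real.dist_eq] at ha
  have hab : |(|a| - |b|)| < δ := (abs_abs_sub_abs_le a b).trans_lt ha
  rw [dist_eq_norm]
  rcases le_total |b| |a| with h | h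
  · exact (hmono (abs_nonneg b) h).trans_lt (hsmall hab)
  · rw [norm_sub_rev]
    exact (hmono (abs_nonneg a) h).trans_lt (hsmall (by rwa [abs_sub_comm]))

theorem contraction_semigroup_continuous_difference_abs (hT0 : T 0 = 1)
    (hadd : ∀ t u : ℝ, 0 ≤ t → 0 ≤ u → T (t + u) = T t ∘L T u)
    (hcont : ∀ f : B, Tendsto (fun t : ℝ => T t f) (nhdsWithin 0 (Set.Ioi 0)) (nhds f))
    (hcontr : ∀ t : ℝ, 0 ≤ t → ∀ f : B, ‖T t f‖ ≤ ‖f‖) (r : ℕ) (f : B) :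
    Continuous fun u : ℝ => ((T |u| - 1 : B →L[ℝ] B) ^ r) f := by
  have hexp (u : ℝ) : ((T |u| - 1 : B →L[ℝ] B) ^ r) f = ∑ j ∈ Finset.range (r + 1),
      ((-1) ^ (r - j) * (r.choose j : B →L[ℝ] B)) (T |(j * u)| f) := by
    rw [sub_one_pow_eq_sum, sum_apply]
    refine Finset.sum_congr rfl fun j _ => ?_
    rw [semigroup_pow hT0 hadd (abs_nonneg u), abs_mul, Nat.abs_cast]
    rfl
  simp_rw [hexp]
  have hT := contraction_semigroup_continuous_abs hT0 hadd hcont hcontr f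
  exact continuous_finsetSum _ fun j _ => (ContinuousLinearMap.continuous _).comp
    (hT.comp (continuous_const.mul continuous_id))

theorem norm_contraction_sub_one_pow_le {A : B →L[ℝ] B} (hA : ∀ f, ‖A f‖ ≤ ‖f‖) (r : ℕ) (f : B) :
    ‖((A - 1 : B →L[ℝ] B) ^ r) f‖ ≤ 2 ^ r * ‖f‖ := by
  induction r with
  | zero => simp
  | succ r ih =>
    rw [pow_succ']
    calc ‖A (((A - 1) ^ r) f) - ((A - 1) ^ r) f‖ ≤ ‖((A - 1) ^ r) f‖ + ‖((A - 1) ^ r) f‖ :=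
          (norm_sub_le _ _).trans (add_le_add_left (hA _) _)
      _ ≤ 2 ^ (r + 1) * ‖f‖ := by rw [pow_succ]; linarith

theorem norm_contraction_sq_sub_one_pow_le {A : B →L[ℝ] B} (hA : ∀ f, ‖A f‖ ≤ ‖f‖) (r : ℕ)
    (f : B) : ‖((A ^ 2 - 1 : B →L[ℝ] B) ^ r) f‖ ≤ 2 ^ r * ‖((A - 1 : B →L[ℝ] B) ^ r) f‖ := by
  have hplus (n : ℕ) (g : B) : ‖((A + 1 : B →L[ℝ] B) ^ n) g‖ ≤ 2 ^ n * ‖g‖ := by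
    induction n with
    | zero => simp
    | succ n ih =>
      rw [pow_succ']
      calc ‖A (((A + 1) ^ n) g) + ((A + 1) ^ n) g‖ ≤ ‖((A + 1) ^ n) g‖ + ‖((A + 1) ^ n) g‖ :=
            (norm_add_le _ _).trans (add_le_add_left (hA _) _)
        _ ≤ 2 ^ (n + 1) * ‖g‖ := by rw [pow_succ]; linarith
  have hfac : (A ^ 2 - 1 : B →L[ℝ] B) ^ r = (A + 1) ^ r * (A - 1) ^ r := by
    have hc : Commute (A + 1) (A - 1) :=
      ((Commute.refl A).add_left (Commute.one_left A)).sub_right (Commute.one_right _)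
    rw [← hc.mul_pow]
    congr 1
    noncomm_ring
  rw [hfac]
  exact hplus r _

theorem contraction_semigroup_difference_inequality (hT0 : T 0 = 1)
    (hadd : ∀ t u : ℝ, 0 ≤ t → 0 ≤ u → T (t + u) = T t ∘L T u)
    (hcontr : ∀ t : ℝ, 0 ≤ t → ∀ f : B, ‖T t f‖ ≤ ‖f‖) {r : ℕ} (hr : 1 ≤ r) (f : B) {h s : ℝ}
    (hh : 0 ≤ h) (hs : 0 ≤ s) :
    ‖((T h - 1 : B →L[ℝ] B) ^ r) f‖ ≤ ∑ k ∈ Finset.range r, (r.choose (k + 1) : ℝ) *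
      (‖((T ((k + 1 : ℝ) * s) - 1 : B →L[ℝ] B) ^ r) f‖ +
        ‖((T (h + (k + 1 : ℝ) * s) - 1 : B →L[ℝ] B) ^ r) f‖) := by
  have hid := sum_choose_mul_pow_sub_one_pow (semigroup_commute hadd hh hs) r
  rw [Finset.sum_range_succ', Finset.sum_range_succ' (fun k =>
    ((-1) ^ k * (r.choose k : B →L[ℝ] B)) * (T h * T s ^ k - 1) ^ r)] at hid
  simp only [pow_zero, Nat.choose_zero_right, Nat.cast_one, sub_self, mul_one, one_mul,
    zero_pow (Nat.one_le_iff_ne_zero.mp hr), add_zero] at hid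
  have hmain : (T h - 1 : B →L[ℝ] B) ^ r = ∑ k ∈ Finset.range r,
      ((-1) ^ (k + 1) * (r.choose (k + 1) : B →L[ℝ] B)) *
        (T h ^ (k + 1) * (T ((k + 1 : ℝ) * s) - 1) ^ r -
          (T (h + (k + 1 : ℝ) * s) - 1) ^ r) := by
    rw [← sub_eq_iff_eq_add', ← Finset.sum_sub_distrib] at hid
    rw [← hid]
    refine Finset.sum_congr rfl fun k _ => ?_
    rw [← mul_sub, hadd h _ hh (by positivity), semigroup_pow hT0 hadd hs, Nat.cast_succ]
    rfl
  rw [hmain, sum_apply]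
  refine (norm_sum_le _ _).trans (Finset.sum_le_sum fun k _ => ?_)
  have hcoef (g : B) : ‖((-1) ^ (k + 1) * (r.choose (k + 1) : B →L[ℝ] B)) g‖ =
      (r.choose (k + 1) : ℝ) * ‖g‖ := by
    have hn (n : ℕ) : (n : B →L[ℝ] B) g = (n : ℝ) • g := by
      rw [← nsmul_one, Nat.cast_smul_eq_nsmul]
      rfl
    rcases neg_one_pow_eq_or (B →L[ℝ] B) (k + 1) with h | h <;>
      simp [h, hn, norm_smul]
  rw [mul_apply_eq_comp, hcoef]
  gcongr
  refine (norm_sub_le _ _).trans (add_le_add_left ?_ _)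
  rw [semigroup_pow hT0 hadd hh]
  exact hcontr _ (by positivity) _

end Semigroup

/-- For a C₀ semigroup of contractions `(T(u))_{u≥0}` on a real Banach space
`B` and an integer `r ≥ 1`, the averaged modulus `w_T^r(f,t) = (1/t)∫_0^t ‖(T(u)−I)^r f‖ du`
and the modulus `ω_T^r(f,t) = sup_{0≤u≤t} ‖(T(u)−I)^r f‖` satisfy
`w_T^r(f,t) ≤ ω_T^r(f,t) ≤ C(r) w_T^r(f,t)` with `C(r) > 0` depending only on `r`. -/
theorem stmt15.{u} (r : ℕ) (hr : 1 ≤ r) :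
    ∃ C : ℝ, 0 < C ∧
      ∀ (B : Type u) [NormedAddCommGroup B] [NormedSpace ℝ B] [CompleteSpace B]
        (T : ℝ → B →L[ℝ] B),
        T 0 = 1 →
        (∀ t u : ℝ, 0 ≤ t → 0 ≤ u → T (t + u) = T t ∘L T u) →
        (∀ f : B, Tendsto (fun t : ℝ => T t f) (nhdsWithin 0 (Set.Ioi 0)) (nhds f)) →
        (∀ t : ℝ, 0 ≤ t → ∀ f : B, ‖T t f‖ ≤ ‖f‖) →
        ∀ f : B, ∀ t : ℝ, 0 < t →
          (1 / t) * (∫ u in Set.Ioc 0 t, ‖((T u - 1 : B →L[ℝ] B) ^ r) f‖) ≤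
              sSup {v : ℝ | ∃ u : ℝ, 0 ≤ u ∧ u ≤ t ∧ v = ‖((T u - 1 : B →L[ℝ] B) ^ r) f‖} ∧
            sSup {v : ℝ | ∃ u : ℝ, 0 ≤ u ∧ u ≤ t ∧ v = ‖((T u - 1 : B →L[ℝ] B) ^ r) f‖} ≤
              C * ((1 / t) * ∫ u in Set.Ioc 0 t, ‖((T u - 1 : B →L[ℝ] B) ^ r) f‖) := by
  have hr' : (0 : ℝ) < r := by exact_mod_cast hr
  refine ⟨2 ^ r * (4 * r * 2 ^ r), by positivity, ?_⟩
  intro B _ _ _ T hT0 hadd hcont hcontr f t ht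
  set φ : ℝ → ℝ := fun u => ‖((T |u| - 1 : B →L[ℝ] B) ^ r) f‖ with hφ
  have hφT {u : ℝ} (hu : 0 ≤ u) : ‖((T u - 1 : B →L[ℝ] B) ^ r) f‖ = φ u := by
    simp only [hφ, abs_of_nonneg hu]
  have hφc : Continuous φ :=
    (contraction_semigroup_continuous_difference_abs hT0 hadd hcont hcontr r f).norm
  have hφ0 (u : ℝ) : 0 ≤ φ u := norm_nonneg _
  have hint : ∫ u in Set.Ioc 0 t, ‖((T u - 1 : B →L[ℝ] B) ^ r) f‖ = ∫ u in (0 : ℝ)..t, φ u := by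
    rw [intervalIntegral.integral_of_le ht.le]
    exact setIntegral_congr_fun measurableSet_Ioc fun u hu => hφT hu.1.le
  have hmean0 : 0 ≤ (1 / t) * ∫ u in (0 : ℝ)..t, φ u :=
    mul_nonneg (by positivity) (intervalIntegral.integral_nonneg ht.le fun u _ => hφ0 u)
  have hbdd : BddAbove
      {v : ℝ | ∃ u : ℝ, 0 ≤ u ∧ u ≤ t ∧ v = ‖((T u - 1 : B →L[ℝ] B) ^ r) f‖} := by
    refine ⟨2 ^ r * ‖f‖, ?_⟩
    rintro _ ⟨u, hu, -, rfl⟩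
    exact norm_contraction_sub_one_pow_le (hcontr u hu) r f
  rw [hint]
  constructor
  · set S := sSup {v : ℝ | ∃ u : ℝ, 0 ≤ u ∧ u ≤ t ∧ v = ‖((T u - 1 : B →L[ℝ] B) ^ r) f‖}
    have hle : ∫ u in (0 : ℝ)..t, φ u ≤ ∫ _ in (0 : ℝ)..t, S :=
      intervalIntegral.integral_mono_on ht.le (hφc.intervalIntegrable _ _) (by simp)
        fun u hu => le_csSup hbdd ⟨u, hu.1, hu.2, (hφT hu.1).symm⟩
    rw [intervalIntegral.integral_const, sub_zero, smul_eq_mul] at hle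
    rw [one_div, inv_mul_le_iff₀ ht]
    exact hle
  · have hdiff (h s : ℝ) (hh : 0 ≤ h) (hs : 0 ≤ s) : φ h ≤ ∑ k ∈ Finset.range r,
        (r.choose (k + 1) : ℝ) * (φ (0 + (k + 1 : ℝ) * s) + φ (h + (k + 1 : ℝ) * s)) := by
      have hmain := contraction_semigroup_difference_inequality hT0 hadd hcontr hr f hh hs
      rw [hφT hh] at hmain
      refine hmain.trans_eq (Finset.sum_congr rfl fun k _ => ?_)
      rw [hφT (by positivity), hφT (by positivity), zero_add]
    refine csSup_le ⟨_, 0, le_rfl, ht.le, rfl⟩ ?_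
    rintro _ ⟨u, hu, hut, rfl⟩
    have hhalf := le_mean_of_difference_inequality hφc hφ0 hr hdiff (by positivity : 0 ≤ u / 2) ht
      (by linarith : u / 2 ≤ t / 2)
    have hdouble := norm_contraction_sq_sub_one_pow_le (hcontr (u / 2) (by positivity)) r f
    rw [semigroup_pow hT0 hadd (by positivity), Nat.cast_two, mul_div_cancel₀ u two_ne_zero,
      hφT (by positivity : 0 ≤ u / 2)] at hdouble
    rw [mul_assoc (2 ^ r)]
    exact hdouble.trans (by gcongr)
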